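/- arXiv:2309.02898 — 3 statements merged into one kernel-verified Lean document; each statement's English description precedes it below -/
import Mathlib

section
/- Define the linear map M2 on (ℝ²)^{n²} by (M2 A)_{(a,a)} = A_{(a,a)} for a ∈ [k] and all other coordinates of M2 A equal to (0,0). Then for every S_I-invariant function ψ : X → ℝ there exists a block-S_{n²}-invariant function φ : (ℝ²)^{n²} × (ℝ²)^n → ℝ such that ψ(x) = φ(M2(ρ_n(M1 x)), Q(x)) for all x ∈ X. -/
/-- Action of a permutation `g` on tuples: `(g · x)_i = x_{g i}`. -/
def permAct {ι α : Type*} (g : Equiv.Perm ι) (x : ι → α) : ι → α := fun i => x (g i)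

/-- `X`: points of `[0,1]^n` with pairwise distinct coordinates. -/
def Xset (n : ℕ) : Set (Fin n → ℝ) :=
  {x | (∀ i, x i ∈ Set.Icc (0 : ℝ) 1) ∧ Function.Injective x}

/-- `ρ_n(x)_{(a,b)} = (x_a, x_b)`, indexing `(ℝ²)^{n²}` by `[n] × [n]`. -/
def rhoN (n : ℕ) (x : Fin n → ℝ) : Fin n × Fin n → ℝ × ℝ := fun p => (x p.1, x p.2)

/-- `M1`: `(M1 x)_u = x_{i_u}` for `u ∈ [k]` and `0` otherwise, where
`e : Fin k → Fin n` enumerates `I = {i_1 < … < i_k}`. -/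
def M1map (n k : ℕ) (e : Fin k → Fin n) (x : Fin n → ℝ) : Fin n → ℝ :=
  fun u => if h : u.val < k then x (e ⟨u.val, h⟩) else 0

/-- `Q(x)_u = (((I_n − M1)x)_u, 0)`. -/
def Qmap (n k : ℕ) (e : Fin k → Fin n) (x : Fin n → ℝ) : Fin n → ℝ × ℝ :=
  fun u => (x u - M1map n k e x u, 0)

/-- `M2` for the locally symmetric case: `(M2 A)_{(a,a)} = A_{(a,a)}` for `a ∈ [k]`,
all other coordinates `(0,0)`. -/
def M2S (n k : ℕ) (A : Fin n × Fin n → ℝ × ℝ) : Fin n × Fin n → ℝ × ℝ :=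
  fun q => if q.1 = q.2 ∧ q.1.val < k then A q else 0

/-- Rearrangements of a permuted tuple are the rearrangements of the tuple. -/
lemma exists_permAct_permAct_eq_iff {ι α : Type*} (h : Equiv.Perm ι) (A B : ι → α) :
    (∃ g, permAct g (permAct h A) = B) ↔ ∃ g, permAct g A = B := by
  constructor
  · rintro ⟨g, rfl⟩
    exact ⟨h * g, rfl⟩
  · rintro ⟨g, rfl⟩
    refine ⟨h⁻¹ * g, ?_⟩
    funext i
    simp [permAct]

/-- Outside the fixed indices of `e`, the coordinates of `x` are determined by `Q x`. -/
lemma eq_of_Qmap_eq {n k : ℕ} {e : Fin k → Fin n} (he : StrictMono e) {x y : Fin n → ℝ}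
    (hQ : Qmap n k e x = Qmap n k e y) (j : Fin n)
    (hj : ∀ h : j.val < k, j < e ⟨j, h⟩) : x j = y j := by
  have hQj : x j - M1map n k e x j = y j - M1map n k e y j :=
    congrArg Prod.fst (congrFun hQ j)
  by_cases h : j.val < k
  · have ih := eq_of_Qmap_eq he hQ (e ⟨j, h⟩) fun _ => he (hj h)
    simp only [M1map, h, dite_true, ih] at hQj
    linarith
  · simpa [M1map, h] using hQj
termination_by n - j.val
decreasing_by
  have hlt : j.val < (e ⟨j, h⟩).val := hj h
  omega

lemma StrictMono.fin_val_le {n k : ℕ} {e : Fin k → Fin n} (he : StrictMono e) (u : Fin k) :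
    u.val ≤ (e u).val := by
  obtain ⟨u, hu⟩ := u
  induction u with
  | zero => exact Nat.zero_le _
  | succ u ih =>
    have hlt : e ⟨u, by omega⟩ < e ⟨u + 1, hu⟩ := he (by simp)
    exact (ih (by omega)).trans_lt hlt

lemma eq_of_Qmap_eq_of_notMem_range {n k : ℕ} {e : Fin k → Fin n} (he : StrictMono e)
    {x y : Fin n → ℝ} (hQ : Qmap n k e x = Qmap n k e y) {j : Fin n}
    (hj : j ∉ Set.range e) : x j = y j :=
  eq_of_Qmap_eq he hQ j fun h =>
    lt_of_le_of_ne (he.fin_val_le ⟨j, h⟩) fun heq => hj ⟨_, heq.symm⟩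

/-- The nonzero entries of `M2 (ρ (M1 x))` are the nonzero coordinates of `x` indexed by `e`. -/
lemma exists_M2S_eq_iff {n k : ℕ} (hkn : k ≤ n) (e : Fin k → Fin n) (x : Fin n → ℝ)
    {v : ℝ} (hv : v ≠ 0) :
    (∃ p, M2S n k (rhoN n (M1map n k e x)) p = (v, v)) ↔ ∃ u, x (e u) = v := by
  constructor
  · rintro ⟨⟨a, b⟩, hp⟩
    by_cases hab : a = b ∧ a.val < k
    · refine ⟨⟨a, hab.2⟩, ?_⟩
      have := congrArg Prod.fst hp
      simpa [M2S, rhoN, M1map, hab.1, hab.1 ▸ hab.2] using this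
    · have := congrArg Prod.fst hp
      simp only [M2S, hab, if_false] at this
      exact absurd this.symm hv
  · rintro ⟨u, rfl⟩
    refine ⟨(⟨u, u.2.trans_le hkn⟩, ⟨u, u.2.trans_le hkn⟩), ?_⟩
    simp [M2S, rhoN, M1map]

/-- Rearranging `M2 (ρ (M1 x))` does not change the set of coordinates of `x` indexed by `e`. -/
lemma image_eq_of_permAct_M2S_eq {n k : ℕ} (hkn : k ≤ n) {e : Fin k → Fin n}
    (he : Function.Injective e) {x y : Fin n → ℝ} (hx : Function.Injective x)
    (hy : Function.Injective y) (g : Equiv.Perm (Fin n × Fin n))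
    (hg : permAct g (M2S n k (rhoN n (M1map n k e x))) = M2S n k (rhoN n (M1map n k e y))) :
    Finset.univ.image (x ∘ e) = Finset.univ.image (y ∘ e) := by
  set S := Finset.univ.image (x ∘ e) with hS
  set T := Finset.univ.image (y ∘ e) with hT
  have hcard : S.card = T.card := by
    rw [hS, hT, Finset.card_image_of_injective _ (hx.comp he),
      Finset.card_image_of_injective _ (hy.comp he)]
  have herase : S.erase 0 = T.erase 0 := by
    ext v
    simp only [Finset.mem_erase, hS, hT, Finset.mem_image, Finset.mem_univ, true_and,
      Function.comp_apply]
    refine and_congr_right fun hv => ?_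
    rw [← exists_M2S_eq_iff hkn e x hv, ← exists_M2S_eq_iff hkn e y hv, ← hg]
    exact g.surjective.exists
  have hmem : (0 : ℝ) ∈ S ↔ (0 : ℝ) ∈ T := by
    have hc := congrArg Finset.card herase
    rw [Finset.card_erase_eq_ite, Finset.card_erase_eq_ite] at hc
    constructor <;> intro h <;> by_contra h' <;>
    · have := Finset.card_pos.mpr ⟨_, h⟩
      simp only [h, h', if_true, if_false] at hc
      omega
  ext v
  by_cases hv : v = 0
  · rw [hv, hmem]
  · simpa [hv] using Finset.ext_iff.mp herase v

/-- Two points of `X` with the same `Q` whose `M2 (ρ (M1 ·))` are rearrangements of each other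
lie in the same orbit of the permutations supported on the range of `e`. -/
lemma exists_permAct_eq {n k : ℕ} (hkn : k ≤ n) {e : Fin k → Fin n} (he : StrictMono e)
    {x y : Fin n → ℝ} (hx : Function.Injective x) (hy : Function.Injective y)
    (hQ : Qmap n k e x = Qmap n k e y)
    (hM : ∃ g, permAct g (M2S n k (rhoN n (M1map n k e x))) = M2S n k (rhoN n (M1map n k e y))) :
    ∃ g : Equiv.Perm (Fin n), (∀ j, j ∉ Set.range e → g j = j) ∧ permAct g x = y := by
  obtain ⟨h, hh⟩ := hM
  have himage := image_eq_of_permAct_M2S_eq hkn he.injective hx hy h hh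
  have hex : ∀ j, ∃ i, x i = y j := by
    intro j
    by_cases hj : j ∈ Set.range e
    · obtain ⟨u, rfl⟩ := hj
      have hu : y (e u) ∈ Finset.univ.image (x ∘ e) := by
        rw [himage]
        exact Finset.mem_image_of_mem (y ∘ e) (Finset.mem_univ u)
      obtain ⟨w, -, hw⟩ := Finset.mem_image.mp hu
      exact ⟨e w, hw⟩
    · exact ⟨j, eq_of_Qmap_eq_of_notMem_range he hQ hj⟩
  choose f hf using hex
  have hinj : Function.Injective f := fun a b hab => hy (by rw [← hf a, ← hf b, hab])
  refine ⟨Equiv.ofBijective f (Finite.injective_iff_bijective.mp hinj), fun j hj => hx ?_,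
    funext hf⟩
  rw [eq_of_Qmap_eq_of_notMem_range he hQ hj]
  exact hf j

/-- Any `S_I`-invariant `ψ : X → ℝ` is expressible as
`x ↦ φ(M2(ρ_n(M1 x)), Q(x))` with `φ` block-`S_{n²}`-invariant. -/
theorem stmt_9 (n k : ℕ) (hn : 2 ≤ n) (hk : 2 ≤ k) (hkn : k ≤ n)
    (e : Fin k → Fin n) (he : StrictMono e)
    (ψ : (Fin n → ℝ) → ℝ)
    (hψ : ∀ g : Equiv.Perm (Fin n), (∀ j, j ∉ Set.range e → g j = j) →
      ∀ x ∈ Xset n, ψ (permAct g x) = ψ x) :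
    ∃ φ : ((Fin n × Fin n → ℝ × ℝ) × (Fin n → ℝ × ℝ)) → ℝ,
      (∀ (g : Equiv.Perm (Fin n × Fin n)) (A : Fin n × Fin n → ℝ × ℝ)
        (q : Fin n → ℝ × ℝ), φ (permAct g A, q) = φ (A, q)) ∧
      ∀ x ∈ Xset n,
        ψ x = φ (M2S n k (rhoN n (M1map n k e x)), Qmap n k e x) := by
  classical
  let P (A : Fin n × Fin n → ℝ × ℝ) (q : Fin n → ℝ × ℝ) (x : Fin n → ℝ) : Prop :=
    x ∈ Xset n ∧ (∃ g, permAct g A = M2S n k (rhoN n (M1map n k e x))) ∧ Qmap n k e x = q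
  refine ⟨fun z => if h : ∃ x, P z.1 z.2 x then ψ h.choose else 0, fun g A q => ?_, fun x hx => ?_⟩
  · have hP : P (permAct g A) q = P A q := by
      funext x
      simp only [P, exists_permAct_permAct_eq_iff]
    simp only [hP]
  · have h : ∃ y, P (M2S n k (rhoN n (M1map n k e x))) (Qmap n k e x) y :=
      ⟨x, hx, ⟨1, rfl⟩, rfl⟩
    obtain ⟨hy, hM, hQ⟩ := h.choose_spec
    obtain ⟨g, hg, hgx⟩ := exists_permAct_eq hkn he hx.2 hy.2 hQ.symm hM
    simp only [dif_pos h]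
    rw [← hgx, hψ g hg x hx]
end

section
/- Let n ≥ 2 and let [n] = I_1 ⊔ … ⊔ I_L be a partition with |I_j| ≥ 2 for every j. For each j choose G_j ∈ {S_{I_j}, D_{I_j}, Z_{I_j}}, and assume the abstract groups G_1, …, G_L are pairwise non-isomorphic and at most one G_j is of the type S_{I_j}. Let G ≤ S_n be the subgroup generated by G_1 ∪ … ∪ G_L. Define ρ : ℝ^n → (ℝ²)^l as the concatenation over j = 1, …, L of the tuples: ((x_i, x_i))_{i ∈ I_j} if G_j = S_{I_j}; ((x_i, x_{π_j(i)}))_{i ∈ I_j} if G_j = Z_{I_j}; and ((x_i, x_{π_j(i)}), (x_{π_j(i)}, x_i))_{i ∈ I_j} if G_j = D_{I_j} (so l is the total number of pairs produced). Then for every G-invariant ψ : X → ℝ there exists a function φ : (ℝ²)^l → ℝ invariant under all permutations of the l pair-coordinates such that ψ(x) = φ(ρ(x)) for all x ∈ X. -/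
/-- The three types of local subgroups: symmetric, dihedral, cyclic. -/
inductive GType | S | D | Z

/-- Number of pairs produced by a block of size `kj` of each type. -/
def blockLen : GType → ℕ → ℕ
  | .S, kj => kj
  | .Z, kj => kj
  | .D, kj => 2 * kj

/-- Index `i ∈ [kj]` associated with a position `v ∈ [2kj]`. -/
def halfIdx {kj : ℕ} (v : Fin (2 * kj)) : Fin kj := ⟨v.val / 2, by have := v.isLt; omega⟩

/-- The tuple of pairs contributed by a block `I_j` enumerated by `e`:
`((x_i, x_i))_i` for type `S`, `((x_i, x_{π_j(i)}))_i` for type `Z`, and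
`((x_i, x_{π_j(i)}), (x_{π_j(i)}, x_i))_i` for type `D`. -/
def blockRho {n : ℕ} (t : GType) (kj : ℕ) (e : Fin kj → Fin n) (x : Fin n → ℝ) :
    Fin (blockLen t kj) → ℝ × ℝ :=
  match t with
  | .S => fun v => (x (e v), x (e v))
  | .Z => fun v => (x (e v), x (e (finRotate kj v)))
  | .D => fun v =>
      if v.val % 2 = 0 then (x (e (halfIdx v)), x (e (finRotate kj (halfIdx v))))
      else (x (e (finRotate kj (halfIdx v))), x (e (halfIdx v)))

/-- The subgroup of permutations of `[n]` fixing every point outside `s`. -/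
def fixingOutside {n : ℕ} (s : Set (Fin n)) : Subgroup (Equiv.Perm (Fin n)) where
  carrier := {g | ∀ m, m ∉ s → g m = m}
  one_mem' := fun _ _ => rfl
  mul_mem' := by
    intro a b ha hb m hm
    simp only [Set.mem_setOf_eq] at *
    rw [Equiv.Perm.mul_apply, hb m hm, ha m hm]
  inv_mem' := by
    intro a ha m hm
    simp only [Set.mem_setOf_eq] at *
    conv_lhs => rw [← ha m hm]
    simp

/-- The local subgroup of `S_n` attached to a block: `S_I`, `Z_I = ⟨π⟩` or
`D_I = ⟨π, σ⟩`. -/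
def groupOf {n : ℕ} (t : GType) (I : Set (Fin n)) (π σ : Equiv.Perm (Fin n)) :
    Subgroup (Equiv.Perm (Fin n)) :=
  match t with
  | .S => fixingOutside I
  | .Z => Subgroup.zpowers π
  | .D => Subgroup.closure {π, σ}

/-- Adjacency of positions in a block of size `k`: a loop at each position for type `S`, the
directed cycle for type `Z` and the undirected cycle for type `D`. -/
def blockEdge (t : GType) {k : ℕ} (u v : Fin k) : Prop :=
  match t with
  | .S => v = u
  | .Z => v = finRotate k u
  | .D => v = finRotate k u ∨ u = finRotate k v

/-- The symmetric, cyclic or dihedral group acting on the positions of a block. -/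
def positionGroup (t : GType) (k : ℕ) : Subgroup (Equiv.Perm (Fin k)) :=
  match t with
  | .S => ⊤
  | .Z => Subgroup.zpowers (finRotate k)
  | .D => Subgroup.closure {finRotate k, Fin.revPerm}

theorem finRotate_induction {k : ℕ} {P : Fin k → Prop} (u₀ : Fin k) (h₀ : P u₀)
    (step : ∀ u, P u → P (finRotate k u)) (u : Fin k) : P u := by
  obtain _ | m := k
  · exact u.elim0
  have key : ∀ w : Fin (m + 1), P (u₀ + w) := by
    intro w
    induction w using Fin.induction with
    | zero => simpa using h₀
    | succ w ih =>
      have := step _ ih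
      rwa [finRotate_apply, add_assoc, Fin.coeSucc_eq_succ] at this
  simpa using key (u - u₀)

theorem finRotate_ne_self {k : ℕ} (hk : 2 ≤ k) (u : Fin k) : finRotate k u ≠ u := by
  obtain ⟨m, rfl⟩ := Nat.exists_eq_add_of_le' hk
  rw [finRotate_apply]
  simp

theorem eq_two_of_finRotate_finRotate {k : ℕ} (hk : 2 ≤ k) {u : Fin k}
    (h : u = finRotate k (finRotate k u)) : k = 2 := by
  obtain ⟨m, rfl⟩ := Nat.exists_eq_add_of_le' hk
  rw [finRotate_apply, finRotate_apply, add_assoc, left_eq_add] at h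
  by_contra hm
  have h2 := congrArg Fin.val h
  rw [Fin.val_add, Fin.val_one, Nat.mod_eq_of_lt (by omega)] at h2
  simp at h2

theorem mem_zpowers_finRotate_of_comm {k : ℕ} (f : Equiv.Perm (Fin k))
    (h : ∀ u, f (finRotate k u) = finRotate k (f u)) :
    f ∈ Subgroup.zpowers (finRotate k) := by
  obtain _ | m := k
  · rw [Subsingleton.elim f 1]
    exact one_mem _
  obtain ⟨a, ha⟩ : ∃ a : ℕ, f 0 = (finRotate (m + 1) ^ a) 0 := by
    refine finRotate_induction (P := fun w => ∃ a : ℕ, w = (finRotate (m + 1) ^ a) 0) 0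
      ⟨0, rfl⟩ ?_ (f 0)
    rintro _ ⟨a, rfl⟩
    exact ⟨a + 1, by rw [pow_succ']; rfl⟩
  refine ⟨a, Equiv.ext fun u => ?_⟩
  change (finRotate (m + 1) ^ (a : ℤ)) u = f u
  rw [zpow_natCast]
  refine finRotate_induction (P := fun u => (finRotate (m + 1) ^ a) u = f u) 0 ha.symm ?_ u
  intro u hu
  rw [h, ← hu, ← Equiv.Perm.mul_apply, ← Equiv.Perm.mul_apply, pow_mul_comm']

theorem finRotate_rev_finRotate {k : ℕ} (u : Fin k) :
    finRotate k (Fin.rev (finRotate k u)) = Fin.rev u := by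
  obtain _ | m := k
  · exact u.elim0
  rw [finRotate_apply, finRotate_apply, Fin.rev_add, sub_add_cancel]

theorem comm_finRotate_of_adj {k : ℕ} (f : Equiv.Perm (Fin k)) (u₀ : Fin k)
    (h₀ : f (finRotate k u₀) = finRotate k (f u₀))
    (h : ∀ u, f (finRotate k u) = finRotate k (f u) ∨ f u = finRotate k (f (finRotate k u)))
    (u : Fin k) : f (finRotate k u) = finRotate k (f u) := by
  refine finRotate_induction (P := fun u => f (finRotate k u) = finRotate k (f u)) u₀ h₀ ?_ u
  intro u hu
  rcases h (finRotate k u) with h' | h'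
  · exact h'
  · have h2 : u = finRotate k (finRotate k u) :=
      f.injective ((finRotate k).injective (hu.symm.trans h'))
    rw [← h2, hu]
    obtain _ | m := k
    · exact u.elim0
    simp only [finRotate_apply] at h2 ⊢
    rw [add_assoc, left_eq_add] at h2
    rw [add_assoc, h2, add_zero]

theorem mem_closure_finRotate_revPerm_of_adj {k : ℕ} (f : Equiv.Perm (Fin k))
    (h : ∀ u, f (finRotate k u) = finRotate k (f u) ∨ f u = finRotate k (f (finRotate k u))) :
    f ∈ Subgroup.closure {finRotate k, Fin.revPerm} := by
  have hle : Subgroup.zpowers (finRotate k) ≤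
      Subgroup.closure {finRotate k, (Fin.revPerm : Equiv.Perm (Fin k))} :=
    Subgroup.zpowers_le.2 (Subgroup.subset_closure (by simp))
  obtain _ | m := k
  · rw [Subsingleton.elim f 1]
    exact one_mem _
  rcases h 0 with h0 | h0
  · exact hle (mem_zpowers_finRotate_of_comm f (comm_finRotate_of_adj f 0 h0 h))
  · have hrev : ∀ u w : Fin (m + 1), u = finRotate (m + 1) w →
        Fin.rev w = finRotate (m + 1) (Fin.rev u) := by
      rintro _ w rfl
      rw [finRotate_rev_finRotate]
    have hmem : Fin.revPerm * f ∈ Subgroup.zpowers (finRotate (m + 1)) :=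
      mem_zpowers_finRotate_of_comm _ (comm_finRotate_of_adj _ 0 (hrev _ _ h0)
        fun u => (h u).symm.imp (hrev _ _) (hrev _ _))
    exact (Subgroup.mul_mem_cancel_left _ (Subgroup.subset_closure (by simp))).1 (hle hmem)

theorem mem_positionGroup_of_edge {t : GType} {k : ℕ} (f : Equiv.Perm (Fin k))
    (h : ∀ u v, blockEdge t u v → blockEdge t (f u) (f v)) : f ∈ positionGroup t k := by
  cases t with
  | S => exact Subgroup.mem_top f
  | Z => exact mem_zpowers_finRotate_of_comm f fun u => h u _ rfl
  | D => exact mem_closure_finRotate_revPerm_of_adj f fun u => h u _ (Or.inl rfl)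

theorem positionGroup_two : positionGroup .D 2 = positionGroup .Z 2 := by
  have h : (Fin.revPerm : Equiv.Perm (Fin 2)) = finRotate 2 := by decide
  simp [positionGroup, h, Subgroup.zpowers_eq_closure]

theorem viaEmbedding_eq_of_apply {α β : Type*} (ι : α ↪ β) (p : Equiv.Perm α) (q : Equiv.Perm β)
    (h : ∀ u, q (ι u) = ι (p u)) (h' : ∀ m, m ∉ Set.range ι → q m = m) :
    Equiv.Perm.viaEmbeddingHom ι p = q := by
  ext m
  by_cases hm : m ∈ Set.range ι
  · obtain ⟨u, rfl⟩ := hm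
    rw [h]
    exact Equiv.Perm.viaEmbedding_apply p ι u
  · rw [h' m hm]
    exact Equiv.Perm.viaEmbedding_apply_of_notMem p ι m hm

theorem map_positionGroup {n k : ℕ} (t : GType) (ι : Fin k ↪ Fin n) (π σ : Equiv.Perm (Fin n))
    (hπ : ∀ u, π (ι u) = ι (finRotate k u)) (hπ' : ∀ m, m ∉ Set.range ι → π m = m)
    (hσ : ∀ u, σ (ι u) = ι (Fin.revPerm u)) (hσ' : ∀ m, m ∉ Set.range ι → σ m = m) :
    (positionGroup t k).map (Equiv.Perm.viaEmbeddingHom ι) ≤ groupOf t (Set.range ι) π σ ∧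
      (t ≠ .S →
        (positionGroup t k).map (Equiv.Perm.viaEmbeddingHom ι) = groupOf t (Set.range ι) π σ) := by
  have h1 := viaEmbedding_eq_of_apply ι _ π hπ hπ'
  have h2 := viaEmbedding_eq_of_apply ι _ σ hσ hσ'
  cases t with
  | S =>
    refine ⟨?_, fun h => absurd rfl h⟩
    rintro _ ⟨p, -, rfl⟩ m hm
    exact Equiv.Perm.viaEmbedding_apply_of_notMem p ι m hm
  | Z =>
    have : (positionGroup .Z k).map (Equiv.Perm.viaEmbeddingHom ι) =
        groupOf .Z (Set.range ι) π σ := by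
      simp only [positionGroup, groupOf, MonoidHom.map_zpowers, h1]
    exact ⟨this.le, fun _ => this⟩
  | D =>
    have : (positionGroup .D k).map (Equiv.Perm.viaEmbeddingHom ι) =
        groupOf .D (Set.range ι) π σ := by
      simp only [positionGroup, groupOf, MonoidHom.map_closure, Set.image_pair, h1, h2]
    exact ⟨this.le, fun _ => this⟩

theorem exists_blockRho_eq_iff {n : ℕ} (t : GType) (k : ℕ) (e : Fin k → Fin n) (x : Fin n → ℝ)
    (q : ℝ × ℝ) :
    (∃ v, blockRho t k e x v = q) ↔ ∃ u v, blockEdge t u v ∧ (x (e u), x (e v)) = q := by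
  cases t with
  | S => exact ⟨fun ⟨v, h⟩ => ⟨v, v, rfl, h⟩, fun ⟨u, v, hv, h⟩ => ⟨u, by cases hv; exact h⟩⟩
  | Z => exact ⟨fun ⟨v, h⟩ => ⟨v, _, rfl, h⟩, fun ⟨u, v, hv, h⟩ => ⟨u, by cases hv; exact h⟩⟩
  | D =>
    constructor
    · rintro ⟨v, h⟩
      simp only [blockRho] at h
      split_ifs at h
      · exact ⟨_, _, Or.inl rfl, h⟩
      · exact ⟨_, _, Or.inr rfl, h⟩
    · rintro ⟨u, v, rfl | rfl, h⟩
      · refine ⟨(⟨2 * u.val, by have := u.isLt; omega⟩ : Fin (2 * k)), ?_⟩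
        have h' : halfIdx (⟨2 * u.val, by have := u.isLt; omega⟩ : Fin (2 * k)) = u := by
          ext; simp [halfIdx]
        simpa [blockRho, h'] using h
      · refine ⟨(⟨2 * v.val + 1, by have := v.isLt; omega⟩ : Fin (2 * k)), ?_⟩
        have h' : halfIdx (⟨2 * v.val + 1, by have := v.isLt; omega⟩ : Fin (2 * k)) = v := by
          ext; simp only [halfIdx]; omega
        simpa [blockRho, h', Nat.add_mod] using h

/-- `τ` maps the edges of the blocks to edges of blocks. -/
def PreservesEdges {n L : ℕ} {k : Fin L → ℕ} (e : ∀ j, Fin (k j) → Fin n) (t : Fin L → GType)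
    (τ : Equiv.Perm (Fin n)) : Prop :=
  ∀ j u v, blockEdge (t j) u v →
    ∃ i u' v', blockEdge (t i) u' v' ∧ τ (e j u) = e i u' ∧ τ (e j v) = e i v'

theorem blockEdge_self {t : GType} {k : ℕ} (hk : 2 ≤ k) {u : Fin k} (h : blockEdge t u u) :
    t = .S := by
  cases t with
  | S => rfl
  | Z => exact absurd h.symm (finRotate_ne_self hk u)
  | D => exact absurd (or_self_iff.1 h).symm (finRotate_ne_self hk u)

theorem exists_blockEdge (t : GType) {k : ℕ} (u : Fin k) : ∃ v, blockEdge t u v := by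
  cases t with
  | S => exact ⟨u, rfl⟩
  | Z => exact ⟨_, rfl⟩
  | D => exact ⟨_, Or.inl rfl⟩

theorem blockEdge_finRotate {t : GType} (ht : t ≠ .S) {k : ℕ} (u : Fin k) :
    blockEdge t u (finRotate k u) := by
  cases t with
  | S => exact absurd rfl ht
  | Z => rfl
  | D => exact Or.inl rfl

/-- An edge-preserving permutation maps every block into a block. -/
theorem PreservesEdges.exists_block {n L : ℕ} {k : Fin L → ℕ} (hk : ∀ j, 2 ≤ k j)
    {e : ∀ j, Fin (k j) → Fin n} (he : ∀ j, Function.Injective (e j))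
    (hblock : ∀ {i j u v}, e i u = e j v → i = j)
    {t : Fin L → GType} (honeS : ∀ i j, t i = GType.S → t j = GType.S → i = j)
    {τ : Equiv.Perm (Fin n)} (hτ : PreservesEdges e t τ) (j : Fin L) :
    ∃ i, ∃ f : Fin (k j) → Fin (k i), (∀ u, τ (e j u) = e i (f u)) ∧
      ∀ u v, blockEdge (t j) u v → blockEdge (t i) (f u) (f v) := by
  suffices h : ∃ i, ∀ u, ∃ u', τ (e j u) = e i u' by
    obtain ⟨i, h⟩ := h
    choose f hf using h
    refine ⟨i, f, hf, fun u v huv => ?_⟩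
    obtain ⟨i', u', v', h', hu, hv⟩ := hτ j u v huv
    rw [hf] at hu hv
    obtain rfl := hblock hu
    rwa [he _ hu, he _ hv]
  by_cases hS : t j = .S
  · refine ⟨j, fun u => ?_⟩
    obtain ⟨i, u', v', h', hu, hv⟩ := hτ j u u (by rw [hS]; rfl)
    obtain rfl := he _ (hu.symm.trans hv)
    obtain rfl := honeS _ _ hS (blockEdge_self (hk i) h')
    exact ⟨u', hu⟩
  · let u₀ : Fin (k j) := ⟨0, by have := hk j; omega⟩
    obtain ⟨i, u', v', -, hu, -⟩ := hτ j u₀ _ (blockEdge_finRotate hS u₀)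
    refine ⟨i, finRotate_induction u₀ ⟨u', hu⟩ ?_⟩
    rintro u ⟨w, hw⟩
    obtain ⟨i', w', v', -, hw', hv⟩ := hτ j u _ (blockEdge_finRotate hS u)
    obtain rfl := hblock (hw.symm.trans hw')
    exact ⟨v', hv⟩

/-- Blocks with isomorphic graphs coincide in type, except that the cyclic and dihedral types agree
in size two. -/
theorem type_eq_of_blockEdge_equiv {t t' : GType} {k k' : ℕ} (hk : 2 ≤ k)
    (f : Fin k ≃ Fin k')
    (h : ∀ u v, blockEdge t u v ↔ blockEdge t' (f u) (f v)) :
    t = t' ∨ t ≠ .S ∧ t' ≠ .S ∧ k = 2 := by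
  have hkk : k = k' := by simpa using Fintype.card_congr f
  subst hkk
  let u₀ : Fin k := ⟨0, by omega⟩
  by_cases hS : t = .S
  · subst hS
    exact Or.inl (blockEdge_self hk ((h u₀ u₀).1 rfl)).symm
  by_cases hS' : t' = .S
  · subst hS'
    exact absurd (blockEdge_self hk ((h u₀ u₀).2 rfl)) hS
  by_cases hk2 : k = 2
  · exact Or.inr ⟨hS, hS', hk2⟩
  refine Or.inl ?_
  cases t <;> cases t' <;> first | rfl | exact absurd rfl hS | exact absurd rfl hS' | skip
  · have h1 : f (finRotate k u₀) = finRotate k (f u₀) := (h _ _).1 (Or.inl rfl)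
    have h2 : f u₀ = finRotate k (f (finRotate k u₀)) := (h _ _).1 (Or.inr rfl)
    rw [h1] at h2
    exact absurd (eq_two_of_finRotate_finRotate hk h2) hk2
  · have h1 : f.symm (finRotate k (f u₀)) = finRotate k u₀ := by
      have := (h u₀ (f.symm (finRotate k (f u₀)))).2 (by simp [blockEdge])
      exact this
    have h2 : u₀ = finRotate k (f.symm (finRotate k (f u₀))) :=
      (h (f.symm (finRotate k (f u₀))) u₀).2 (by simp [blockEdge])
    rw [h1] at h2
    exact absurd (eq_two_of_finRotate_finRotate hk h2) hk2

theorem nonempty_positionGroup_mulEquiv {t t' : GType} {k k' : ℕ} (hk : 2 ≤ k)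
    (f : Fin k ≃ Fin k') (h : ∀ u v, blockEdge t u v ↔ blockEdge t' (f u) (f v)) :
    Nonempty (positionGroup t k ≃* positionGroup t' k') := by
  have hkk : k = k' := by simpa using Fintype.card_congr f
  subst hkk
  rcases type_eq_of_blockEdge_equiv hk f h with rfl | ⟨h1, h2, rfl⟩
  · exact ⟨MulEquiv.refl _⟩
  · have key : ∀ s : GType, s ≠ .S → positionGroup s 2 = positionGroup .Z 2 := by
      rintro (_ | _ | _) hs
      exacts [absurd rfl hs, positionGroup_two, rfl]
    exact ⟨MulEquiv.subgroupCongr ((key t h1).trans (key t' h2).symm)⟩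

/-- A permutation acting on every block through an element of `G` lies in `G`. -/
theorem mem_of_forall_block {n L : ℕ} {k : Fin L → ℕ} (ι : ∀ j, Fin (k j) ↪ Fin n)
    (hblock : ∀ {i j u v}, ι i u = ι j v → i = j) (hcover : ∀ m : Fin n, ∃ j u, ι j u = m)
    (G : Subgroup (Equiv.Perm (Fin n))) (τ : Equiv.Perm (Fin n))
    (f : ∀ j, Equiv.Perm (Fin (k j))) (hf : ∀ j u, τ (ι j u) = ι j (f j u))
    (hG : ∀ j, Equiv.Perm.viaEmbeddingHom (ι j) (f j) ∈ G) : τ ∈ G := by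
  have key : ∀ s : Finset (Fin L), ∃ g ∈ G, (∀ j ∈ s, ∀ u, g (ι j u) = τ (ι j u)) ∧
      ∀ j ∉ s, ∀ u, g (ι j u) = ι j u := by
    intro s
    induction s using Finset.induction_on with
    | empty => exact ⟨1, one_mem _, by simp, by simp⟩
    | insert a s ha ih =>
      obtain ⟨g, hg, h1, h2⟩ := ih
      have hne : ∀ j, j ≠ a → ∀ u,
          Equiv.Perm.viaEmbeddingHom (ι a) (f a) (ι j u) = ι j u := by
        intro j hj u
        refine Equiv.Perm.viaEmbedding_apply_of_notMem _ _ _ ?_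
        rintro ⟨v, hv⟩
        exact hj (hblock hv).symm
      refine ⟨g * Equiv.Perm.viaEmbeddingHom (ι a) (f a), mul_mem hg (hG a), ?_, ?_⟩
      · intro j hj u
        rw [Equiv.Perm.mul_apply]
        by_cases hja : j = a
        · subst hja
          rw [hf, ← h2 j ha (f j u)]
          exact congrArg g (Equiv.Perm.viaEmbedding_apply (f j) (ι j) u)
        · rw [hne j hja, h1 j (Finset.mem_of_mem_insert_of_ne hj hja)]
      · intro j hj u
        rw [Finset.mem_insert, not_or] at hj
        rw [Equiv.Perm.mul_apply, hne j hj.1, h2 j hj.2]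
  obtain ⟨g, hg, h1, -⟩ := key Finset.univ
  have : g = τ := by
    ext m
    obtain ⟨j, u, rfl⟩ := hcover m
    rw [h1 j (Finset.mem_univ j)]
  exact this ▸ hg

/-- A function constant on the fibres of a map up to permutation factors through the map by a
permutation-invariant function. -/
theorem exists_permAct_invariant_factor {α κ β : Type*} (X : Set α) (ρ : α → κ → β) (ψ : α → ℝ)
    (h : ∀ x ∈ X, ∀ y ∈ X, ∀ g : Equiv.Perm κ, ρ y = permAct g (ρ x) → ψ y = ψ x) :
    ∃ φ : (κ → β) → ℝ, (∀ (g : Equiv.Perm κ) A, φ (permAct g A) = φ A) ∧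
      ∀ x ∈ X, ψ x = φ (ρ x) := by
  classical
  let F : Set α → ℝ := fun s => if hs : s.Nonempty then ψ hs.some else 0
  refine ⟨fun A => F {x | x ∈ X ∧ ∃ g : Equiv.Perm κ, ρ x = permAct g A}, fun g A => ?_,
    fun x hx => ?_⟩
  · refine congrArg F (Set.ext fun x => and_congr_right fun _ => ⟨?_, ?_⟩)
    · rintro ⟨g', hg'⟩
      exact ⟨g * g', hg'⟩
    · rintro ⟨g', hg'⟩
      exact ⟨g⁻¹ * g', by rw [hg']; ext i; simp [permAct]⟩
  · have hs : {z | z ∈ X ∧ ∃ g : Equiv.Perm κ, ρ z = permAct g (ρ x)}.Nonempty :=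
      ⟨x, hx, 1, rfl⟩
    obtain ⟨hz, g, hg⟩ := hs.some_mem
    change ψ x = dite _ _ _
    rw [dif_pos hs, h x hx _ hz g hg]

/-- Invariance to product groups: if `[n] = I_1 ⊔ … ⊔ I_L`, each block carries a
group `G_j ∈ {S_{I_j}, D_{I_j}, Z_{I_j}}`, the `G_j` are pairwise non-isomorphic,
at most one is of symmetric type, and `G = ⟨G_1 ∪ … ∪ G_L⟩`, then every
`G`-invariant `ψ : X → ℝ` factors as `ψ = φ ∘ ρ` with `φ` invariant under all
permutations of the `l` pair-coordinates. -/
theorem stmt_12 (n L : ℕ) (hn : 2 ≤ n)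
    (k : Fin L → ℕ) (hk : ∀ j, 2 ≤ k j)
    (e : ∀ j, Fin (k j) → Fin n) (he : ∀ j, StrictMono (e j))
    (hdisj : ∀ i j, i ≠ j → ∀ u v, e i u ≠ e j v)
    (hcover : ∀ m : Fin n, ∃ j u, e j u = m)
    (t : Fin L → GType)
    (π σ : Fin L → Equiv.Perm (Fin n))
    (hπ : ∀ j u, π j (e j u) = e j (finRotate (k j) u))
    (hπ' : ∀ j m, m ∉ Set.range (e j) → π j m = m)
    (hσ : ∀ j u, σ j (e j u) = e j (Fin.revPerm u))
    (hσ' : ∀ j m, m ∉ Set.range (e j) → σ j m = m)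
    (hnoniso : ∀ i j, i ≠ j →
      IsEmpty ((groupOf (t i) (Set.range (e i)) (π i) (σ i)) ≃*
               (groupOf (t j) (Set.range (e j)) (π j) (σ j))))
    (honeS : ∀ i j, t i = GType.S → t j = GType.S → i = j)
    (ψ : (Fin n → ℝ) → ℝ)
    (hψ : ∀ g ∈ ⨆ j, groupOf (t j) (Set.range (e j)) (π j) (σ j),
      ∀ x ∈ Xset n, ψ (permAct g x) = ψ x) :
    ∃ φ : ((Σ j, Fin (blockLen (t j) (k j))) → ℝ × ℝ) → ℝ,
      (∀ (g : Equiv.Perm (Σ j, Fin (blockLen (t j) (k j))))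
        (A : (Σ j, Fin (blockLen (t j) (k j))) → ℝ × ℝ),
        φ (permAct g A) = φ A) ∧
      ∀ x ∈ Xset n, ψ x = φ (fun p => blockRho (t p.1) (k p.1) (e p.1) x p.2) := by
  have hblock : ∀ {i j u v}, e i u = e j v → i = j := fun {i j u v} h => by
    by_contra hij
    exact hdisj i j hij u v h
  let ι : ∀ j, Fin (k j) ↪ Fin n := fun j => ⟨e j, (he j).injective⟩
  have hmap := fun j => map_positionGroup (t j) (ι j) (π j) (σ j) (hπ j) (hπ' j) (hσ j) (hσ' j)
  have hmem : ∀ τ, PreservesEdges e t τ → PreservesEdges e t τ⁻¹ →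
      τ ∈ ⨆ j, groupOf (t j) (Set.range (e j)) (π j) (σ j) := by
    intro τ hτ hτ'
    have hf : ∀ j, ∃ f : Equiv.Perm (Fin (k j)), (∀ u, τ (e j u) = e j (f u)) ∧
        ∀ u v, blockEdge (t j) u v → blockEdge (t j) (f u) (f v) := by
      intro j
      obtain ⟨i, f, hf, hfe⟩ := hτ.exists_block hk (fun j => (he j).injective) hblock honeS j
      obtain ⟨i', f', hf', hfe'⟩ := hτ'.exists_block hk (fun j => (he j).injective) hblock honeS i
      have hinv : ∀ u, e j u = e i' (f' (f u)) := fun u => by rw [← hf', ← hf]; simp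
      obtain rfl : j = i' := hblock (hinv ⟨0, by have := hk j; omega⟩)
      have hl : ∀ u, f' (f u) = u := fun u => ((he j).injective (hinv u)).symm
      have hr : ∀ w, f (f' w) = w := fun w => (he i).injective (by rw [← hf, ← hf']; simp)
      let F : Fin (k j) ≃ Fin (k i) := ⟨f, f', hl, hr⟩
      have hF : ∀ u v, blockEdge (t j) u v ↔ blockEdge (t i) (F u) (F v) := fun u v =>
        ⟨hfe u v, fun h => by simpa only [F, Equiv.coe_fn_mk, hl] using hfe' _ _ h⟩
      obtain rfl : j = i := by
        by_contra hij
        by_cases hS : t j = .S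
        · rcases type_eq_of_blockEdge_equiv (hk j) F hF with h | h
          · exact hij (honeS _ _ hS (h ▸ hS))
          · exact h.1 hS
        · have hS' : t i ≠ .S := by
            rcases type_eq_of_blockEdge_equiv (hk j) F hF with h | h
            · exact h ▸ hS
            · exact h.2.1
          obtain ⟨E⟩ := nonempty_positionGroup_mulEquiv (hk j) F hF
          have equivOf : ∀ l, t l ≠ .S → Nonempty (positionGroup (t l) (k l) ≃*
              groupOf (t l) (Set.range (e l)) (π l) (σ l)) := fun l hl =>
            ⟨((positionGroup (t l) (k l)).equivMapOfInjective _
              (Equiv.Perm.viaEmbeddingHom_injective (ι l))).trans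
                (MulEquiv.subgroupCongr ((hmap l).2 hl))⟩
          obtain ⟨Ej⟩ := equivOf j hS
          obtain ⟨Ei⟩ := equivOf i hS'
          exact (hnoniso j i hij).false (Ej.symm.trans (E.trans Ei))
      exact ⟨F, hf, hfe⟩
    choose f hf hfe using hf
    refine mem_of_forall_block ι hblock hcover _ τ f hf fun j => ?_
    exact le_iSup (fun j => groupOf (t j) (Set.range (e j)) (π j) (σ j)) j
      ((hmap j).1 (Subgroup.mem_map_of_mem _ (mem_positionGroup_of_edge (f j) (hfe j))))
  refine exists_permAct_invariant_factor (Xset n)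
    (fun x (p : Σ j, Fin (blockLen (t j) (k j))) => blockRho (t p.1) (k p.1) (e p.1) x p.2) ψ ?_
  intro x hx y hy g hg
  have transfer : ∀ (z w : Fin n → ℝ) (g : Equiv.Perm (Σ j, Fin (blockLen (t j) (k j)))),
      ((fun p : Σ j, Fin (blockLen (t j) (k j)) => blockRho (t p.1) (k p.1) (e p.1) w p.2) =
        permAct g (fun p => blockRho (t p.1) (k p.1) (e p.1) z p.2)) →
      ∀ j u v, blockEdge (t j) u v → ∃ i u' v', blockEdge (t i) u' v' ∧
        w (e j u) = z (e i u') ∧ w (e j v) = z (e i v') := by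
    intro z w g hg j u v huv
    obtain ⟨p, hp⟩ := (exists_blockRho_eq_iff (t j) (k j) (e j) w _).2 ⟨u, v, huv, rfl⟩
    have h1 := congrFun hg ⟨j, p⟩
    simp only [permAct, hp] at h1
    obtain ⟨u', v', h', h2⟩ := (exists_blockRho_eq_iff _ _ _ z _).1 ⟨_, h1.symm⟩
    rw [Prod.mk.injEq] at h2
    exact ⟨_, u', v', h', h2.1.symm, h2.2.symm⟩
  have hxy := transfer x y g hg
  have hyx := transfer y x g⁻¹ (by
    rw [hg]
    funext p
    exact (congrArg
      (fun q : Σ j, Fin (blockLen (t j) (k j)) => blockRho (t q.1) (k q.1) (e q.1) x q.2)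
      (g.apply_symm_apply p)).symm)
  have hex : ∀ m, ∃ m', y m = x m' := by
    intro m
    obtain ⟨j, u, rfl⟩ := hcover m
    obtain ⟨v, hv⟩ := exists_blockEdge (t j) u
    obtain ⟨i, u', -, -, h, -⟩ := hxy j u v hv
    exact ⟨_, h⟩
  choose τ₀ hτ₀ using hex
  have hinj : Function.Injective τ₀ := fun a b hab => hy.2 (by rw [hτ₀, hτ₀, hab])
  let τ : Equiv.Perm (Fin n) := Equiv.ofBijective τ₀ (Finite.injective_iff_bijective.1 hinj)
  have hτ : ∀ m, y m = x (τ m) := hτ₀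
  have hmemτ : τ ∈ ⨆ j, groupOf (t j) (Set.range (e j)) (π j) (σ j) := by
    refine hmem τ ?_ ?_
    · intro j u v huv
      obtain ⟨i, u', v', h, hu, hv⟩ := hxy j u v huv
      exact ⟨i, u', v', h, hx.2 (by rw [← hτ, hu]), hx.2 (by rw [← hτ, hv])⟩
    · intro j u v huv
      obtain ⟨i, u', v', h, hu, hv⟩ := hyx j u v huv
      exact ⟨i, u', v', h, hy.2 (by rw [hτ, ← hu]; simp), hy.2 (by rw [hτ, ← hv]; simp)⟩
  have : y = permAct τ x := funext hτ
  rw [this, hψ τ hmemτ x hx]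
end

section
/- Let n ≥ 2 and let σ ∈ S_n be a permutation with at most one fixed point whose nontrivial disjoint cycles have pairwise coprime (hence pairwise distinct) lengths, and let G = ⟨σ⟩ be the cyclic subgroup generated by σ. Define ρ : ℝ^n → (ℝ²)^n by ρ(x) = ((x_1, x_{σ(1)}), (x_2, x_{σ(2)}), …, (x_n, x_{σ(n)})). Then for every G-invariant ψ : X → ℝ there exists a function φ : (ℝ²)^n → ℝ invariant under all permutations of the n pair-coordinates such that ψ(x) = φ(ρ(x)) for all x ∈ X. -/
theorem Multiset.lcm_eq_prod_of_pairwise_coprime {m : Multiset ℕ}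
    (h : m.Pairwise Nat.Coprime) : m.lcm = m.prod := by
  obtain ⟨l, rfl, hl⟩ := h
  induction l with
  | nil => simp
  | cons a l ih =>
    rw [List.pairwise_cons] at hl
    rw [← Multiset.cons_coe, Multiset.lcm_cons, Multiset.prod_cons, ih hl.2]
    exact (Nat.coprime_multiset_prod_right_iff.2 hl.1).lcm_eq_mul

theorem Multiset.nodup_of_pairwise_coprime {m : Multiset ℕ}
    (h : m.Pairwise Nat.Coprime) (h1 : 1 ∉ m) : m.Nodup := by
  obtain ⟨l, rfl, hl⟩ := h
  refine Multiset.coe_nodup.2 (hl.imp_of_mem fun {a b} ha _ hab hne => ?_)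
  subst hne
  exact h1 ((Nat.coprime_self a).1 hab ▸ ha)

/-- A permutation with at most one fixed point and pairwise coprime nontrivial cycle lengths
commutes only with its own powers. -/
theorem Equiv.Perm.centralizer_eq_zpowers {α : Type*} [Fintype α] [DecidableEq α]
    {σ : Equiv.Perm α} (hfix : ∀ i j, σ i = i → σ j = j → i = j)
    (hcop : σ.cycleType.Pairwise Nat.Coprime) :
    Subgroup.centralizer {σ} = Subgroup.zpowers σ := by
  have hle : Subgroup.zpowers σ ≤ Subgroup.centralizer {σ} :=
    Subgroup.zpowers_le.2 (Subgroup.mem_centralizer_singleton_iff.2 rfl)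
  refine (Subgroup.eq_of_le_of_card_ge hle ?_).symm
  have hnodup : σ.cycleType.Nodup := Multiset.nodup_of_pairwise_coprime hcop
    fun h => absurd (Equiv.Perm.one_lt_of_mem_cycleType h) (lt_irrefl 1)
  have hfixed : Fintype.card α - σ.cycleType.sum ≤ 1 := by
    rw [← Equiv.Perm.card_fixedPoints, Fintype.card_le_one_iff]
    exact fun i j => Subtype.ext (hfix i j i.2 j.2)
  have hcount : ∏ k ∈ σ.cycleType.toFinset, (σ.cycleType.count k).factorial = 1 :=
    Finset.prod_eq_one fun k _ =>
      Nat.factorial_eq_one.2 (Multiset.nodup_iff_count_le_one.1 hnodup k)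
  rw [Equiv.Perm.nat_card_centralizer, hcount, Nat.factorial_eq_one.2 hfixed, Nat.card_zpowers,
    ← Equiv.Perm.lcm_cycleType, Multiset.lcm_eq_prod_of_pairwise_coprime hcop, one_mul, mul_one]

/-- Let `σ ∈ S_n` have at most one fixed point and pairwise coprime nontrivial
cycle lengths, and let `G = ⟨σ⟩`. Every `G`-invariant `ψ : X → ℝ` factors as
`ψ = φ ∘ ρ` with `ρ(x)_i = (x_i, x_{σ(i)})` and `φ` invariant under all
permutations of the `n` pair-coordinates. -/
theorem stmt_13 (n : ℕ) (hn : 2 ≤ n) (σ : Equiv.Perm (Fin n))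
    (hfix : ∀ i j, σ i = i → σ j = j → i = j)
    (hcop : σ.cycleType.Pairwise Nat.Coprime)
    (ψ : (Fin n → ℝ) → ℝ)
    (hψ : ∀ g ∈ Subgroup.zpowers σ, ∀ x ∈ Xset n, ψ (permAct g x) = ψ x) :
    ∃ φ : (Fin n → ℝ × ℝ) → ℝ,
      (∀ (g : Equiv.Perm (Fin n)) (A : Fin n → ℝ × ℝ), φ (permAct g A) = φ A) ∧
      ∀ x ∈ Xset n, ψ x = φ (fun i => (x i, x (σ i))) := by
  classical
  let orb (A : Fin n → ℝ × ℝ) (x : Fin n → ℝ) : Prop :=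
    x ∈ Xset n ∧ ∃ g : Equiv.Perm (Fin n), A = permAct g fun i => (x i, x (σ i))
  let pick (Q : (Fin n → ℝ) → Prop) : ℝ := if h : ∃ x, Q x then ψ h.choose else 0
  refine ⟨fun A => pick (orb A), fun g A => congrArg pick (funext fun x => propext ?_), ?_⟩
  · refine and_congr_right fun _ => ⟨fun ⟨k, hk⟩ => ⟨k * g⁻¹, ?_⟩, fun ⟨k, hk⟩ => ⟨k * g, ?_⟩⟩
    · funext i
      simpa [permAct] using congrFun hk (g⁻¹ i)
    · funext i
      simpa [permAct] using congrFun hk (g i)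
  · intro y hy
    have hex : ∃ x, orb (fun i => (y i, y (σ i))) x := ⟨y, hy, 1, rfl⟩
    obtain ⟨hx, g, hg⟩ := hex.choose_spec
    simp only [pick, dif_pos hex]
    generalize hex.choose = x at hx hg
    have hval (i) : y i = x (g i) := congrArg Prod.fst (congrFun hg i)
    have hnext (i) : y (σ i) = x (σ (g i)) := congrArg Prod.snd (congrFun hg i)
    have hmem : g ∈ Subgroup.zpowers σ := by
      rw [← Equiv.Perm.centralizer_eq_zpowers hfix hcop, Subgroup.mem_centralizer_singleton_iff]
      exact Equiv.ext fun i => hx.2 ((hval (σ i)).symm.trans (hnext i))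
    rw [← hψ g hmem x hx]
    exact congrArg ψ (funext hval)
end
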